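/- For every integer N and all y, z ∈ K, the bilinear difference equation holds: q^{−N−1}·z·φ_{N+1}(y,z)·φ_N(y/q,z) + φ_{N+1}(y/q,z)·φ_N(y,z) = (1 + z)·φ_{N+1}(y/q,z/q)·φ_N(y,qz). -/

import Mathlib

open Matrix Finset

/-- The Jacobi--Trudi type determinant: `det (p (n - 2i + j) y z)_{0 ≤ i,j ≤ n-1}`. -/
noncomputable def phiAux {K : Type*} [Field K] (p : ℤ → K → K → K) (n : ℕ) (y z : K) : K :=
  Matrix.det (Matrix.of fun i j : Fin n => p ((n : ℤ) - 2 * ((i : ℕ) : ℤ) + ((j : ℕ) : ℤ)) y z)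

/-- The polynomials `φ_N(y,z)`: for `N ≥ 0` the Jacobi--Trudi determinant (with `φ_0 = 1`
as the empty determinant), and for `N < 0` we set `φ_N = (-1)^(N(N+1)/2) φ_(-N-1)`. -/
noncomputable def phi {K : Type*} [Field K] (p : ℤ → K → K → K) (N : ℤ) (y z : K) : K :=
  if 0 ≤ N then phiAux p N.toNat y z
  else (-1 : K) ^ (N * (N + 1) / 2) * phiAux p (-N - 1).toNat y z

section Plucker

variable {R : Type*} [CommRing R]

/-- The three-term Plücker relation for determinants sharing all but two rows. -/
theorem det_plucker_three_term {n : ℕ} (M : Fin n → Fin (n + 2) → R) (a b c d : Fin (n + 2) → R) :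
    det (of (vecCons a (vecCons b M))) * det (of (vecCons c (vecCons d M)))
      = det (of (vecCons a (vecCons d M))) * det (of (vecCons c (vecCons b M)))
        + det (of (vecCons c (vecCons a M))) * det (of (vecCons d (vecCons b M))) := by
  obtain ⟨L, hL⟩ : ∃ L : (Fin (n + 2) → R) →ₗ[R] R,
      ∀ v, det (of (vecCons v (vecCons b M))) = L v :=
    ⟨(detRowAlternating (n := Fin (n + 2)) (R := R)).toMultilinearMap.toLinearMap
      (vecCons 0 (vecCons b M)) 0, fun v => by
        simp only [MultilinearMap.toLinearMap_apply, AlternatingMap.coe_multilinearMap]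
        congr 1
        ext i j
        refine Fin.cases ?_ (fun i => ?_) i <;> simp [Function.update]⟩
  have hM : ∀ j, L (M j) = 0 := fun j => by
    rw [← hL]
    exact det_zero_of_row_eq (i := 0) (j := j.succ.succ) (Fin.succ_ne_zero _).symm rfl
  set A : Matrix (Fin (n + 2)) (Fin (n + 2)) R := of (vecCons c (vecCons d M)) with hA
  have h0 : A.updateRow 0 a = of (vecCons a (vecCons d M)) := by
    ext i j
    refine Fin.cases ?_ (fun i => ?_) i <;> simp [hA, updateRow_apply]
  have h1 : A.updateRow (Fin.succ 0) a = of (vecCons c (vecCons a M)) := by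
    ext i j
    refine Fin.cases ?_ (fun i => Fin.cases ?_ (fun i => ?_) i) i <;>
      simp [hA, updateRow_apply, Fin.ext_iff]
  have key : A.det • a = det (of (vecCons a (vecCons d M))) • c
      + (det (of (vecCons c (vecCons a M))) • d
        + ∑ j : Fin n, (A.updateRow j.succ.succ a).det • M j) := by
    have h := mulVec_cramer Aᵀ a
    rw [det_transpose] at h
    rw [← h, ← h0, ← h1]
    ext s
    simp only [mulVec, dotProduct, cramer_transpose_apply, Fin.sum_univ_succ, Pi.add_apply,
      Pi.smul_apply, Finset.sum_apply, smul_eq_mul, transpose_apply]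
    simp [hA, mul_comm]
  have h := congrArg L key
  simp only [map_add, map_smul, map_sum, hM, smul_eq_mul, mul_zero, Finset.sum_const_zero,
    add_zero] at h
  rw [hL, hL, hL, mul_comm, h]

/-- Expansion of a determinant whose first row is a geometric progression. -/
theorem det_of_geometric_row_zero {n : ℕ} (A : Matrix (Fin (n + 1)) (Fin (n + 1)) R) (l : R)
    (h : ∀ j : Fin n, A 0 j.succ = l * A 0 j.castSucc) :
    A.det = A 0 0 * det (of fun i j : Fin n => A i.succ j.succ - l * A i.succ j.castSucc) := by
  let B : Matrix (Fin (n + 1)) (Fin (n + 1)) R :=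
    of fun i => Fin.cons (A i 0) fun j : Fin n => A i j.succ - l * A i j.castSucc
  have hAB : A.det = B.det :=
    det_eq_of_forall_col_eq_smul_add_pred (fun _ => l) (fun i => by simp [B])
      (fun i j => by simp [B])
  rw [hAB, det_succ_row_zero, Fin.sum_univ_succ]
  have hz : ∀ j : Fin n, B 0 j.succ = 0 := fun j => by simp [B, h]
  simp only [hz]
  simp [B]
  rfl

end Plucker

section StaircaseDet

variable {R : Type*} [CommRing R]

/-- The staircase Jacobi--Trudi determinant of a sequence. -/
def staircaseDet (n : ℕ) (f : ℤ → R) : R :=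
  det (of fun i j : Fin n => f ((n : ℤ) - 2 * ((i : ℕ) : ℤ) + ((j : ℕ) : ℤ)))

/-- The effect on coefficients of multiplying a generating function by `1 - l * t`. -/
def mulOneSub (l : R) (f : ℤ → R) : ℤ → R := fun k => f k - l * f (k - 1)

theorem mulOneSub_comm (l m : R) (f : ℤ → R) :
    mulOneSub l (mulOneSub m f) = mulOneSub m (mulOneSub l f) := by
  funext k
  simp only [mulOneSub]
  ring

theorem mulOneSub_neg_self (l : R) (f : ℤ → R) :
    mulOneSub (-l) (mulOneSub l f) = fun k => f k - l ^ 2 * f (k - 2) := by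
  funext k
  simp only [mulOneSub, sub_sub]
  norm_num
  ring

theorem mulOneSub_eq_zero {f : ℤ → R} (hf : ∀ k < 0, f k = 0) (l : R) :
    ∀ k < 0, mulOneSub l f k = 0 := fun k hk => by
  simp [mulOneSub, hf k hk, hf (k - 1) (by omega)]

/-- Multiplying the generating function by `1 - c * t ^ 2` is a row operation. -/
theorem staircaseDet_sub_shift_two (n : ℕ) {f : ℤ → R} (hf : ∀ k < 0, f k = 0) (c : R) :
    staircaseDet n (fun k => f k - c * f (k - 2)) = staircaseDet n f := by
  cases n with
  | zero => simp [staircaseDet]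
  | succ n =>
    unfold staircaseDet
    rw [← det_submatrix_equiv_self Fin.revPerm, eq_comm, ← det_submatrix_equiv_self Fin.revPerm]
    refine det_eq_of_forall_row_eq_smul_add_pred (fun _ => c) (fun j => ?_) (fun i j => ?_)
    · have hj := j.is_lt
      simp only [submatrix_apply, of_apply, Fin.revPerm_apply, Fin.val_rev, Fin.val_zero]
      rw [hf (_ - 2) (by omega)]
      ring
    · have hi := i.is_lt
      simp only [submatrix_apply, of_apply, Fin.revPerm_apply, Fin.val_rev, Fin.val_succ,
        Fin.val_castSucc]
      have e : ((n + 1 : ℕ) : ℤ) - 2 * ((n + 1 - ((i : ℕ) + 1) : ℕ) : ℤ)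
          = ((n + 1 : ℕ) : ℤ) - 2 * ((n + 1 - ((i : ℕ) + 1 + 1) : ℕ) : ℤ) - 2 := by omega
      rw [e, add_sub_right_comm, sub_add_cancel]

theorem staircaseDet_bilinear (n : ℕ) (f : ℤ → R) (l m : R) :
    l * (staircaseDet (n + 1) (mulOneSub m f) * staircaseDet n (mulOneSub l f))
      - m * (staircaseDet (n + 1) (mulOneSub l f) * staircaseDet n (mulOneSub m f))
    = (l - m) * (staircaseDet (n + 1) f * staircaseDet n (mulOneSub l (mulOneSub m f))) := by
  let M : Fin n → Fin (n + 2) → R := fun i j => f ((n : ℤ) - 2 - 2 * (i : ℕ) + (j : ℕ))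
  let a : Fin (n + 2) → R := fun j => f ((n : ℤ) + (j : ℕ))
  let g : R → Fin (n + 2) → R := fun x j => x ^ (j : ℕ)
  have h1 : ∀ x, det (of (vecCons (g x) (vecCons a M))) = staircaseDet (n + 1) (mulOneSub x f) := by
    intro x
    rw [det_of_geometric_row_zero _ x (fun j => by simp [g, pow_succ'])]
    simp only [of_apply, cons_val_zero, g, Fin.val_zero, pow_zero, one_mul, staircaseDet]
    congr 1
    ext i j
    refine Fin.cases ?_ (fun i => ?_) i
    · simp only [of_apply, cons_val_succ, cons_val_zero, a, mulOneSub, Fin.val_succ,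
        Fin.val_castSucc, Fin.val_zero]
      push_cast
      ring_nf
    · simp only [of_apply, cons_val_succ, M, mulOneSub, Fin.val_succ, Fin.val_castSucc]
      push_cast
      ring_nf
  have h2 : ∀ x y, det (of (vecCons (g x) (vecCons (g y) M)))
      = (y - x) * staircaseDet n (mulOneSub y (mulOneSub x f)) := by
    intro x y
    rw [det_of_geometric_row_zero _ x (fun j => by simp [g, pow_succ']),
      det_of_geometric_row_zero _ y (fun j => by
        simp only [of_apply, cons_val_succ, cons_val_zero, g, Fin.val_succ,
          Fin.val_castSucc]
        ring)]
    simp only [of_apply, cons_val_zero, cons_val_succ, g, Fin.val_zero, pow_zero, one_mul,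
      staircaseDet, Fin.val_succ, Fin.val_castSucc, zero_add, pow_one, mul_one]
    congr 2
    ext i j
    simp only [of_apply, M, mulOneSub, Fin.val_succ, Fin.val_castSucc]
    push_cast
    ring_nf
  have h0 : mulOneSub 0 f = f := by
    funext k
    simp [mulOneSub]
  have key := det_plucker_three_term M (g m) a (g 0) (g l)
  simp only [h1, h2, h0] at key
  linear_combination key

theorem staircaseDet_bilinear_dual (n : ℕ) {f : ℤ → R} (hf : ∀ k < 0, f k = 0) (l m : R) :
    m * (staircaseDet (n + 1) (mulOneSub m f) * staircaseDet n (mulOneSub l f))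
      - l * (staircaseDet (n + 1) (mulOneSub l f) * staircaseDet n (mulOneSub m f))
    = (m - l) * (staircaseDet (n + 1) (mulOneSub l (mulOneSub m f)) * staircaseDet n f) := by
  have key := staircaseDet_bilinear n (mulOneSub l (mulOneSub m f)) (-l) (-m)
  have hl : ∀ k, staircaseDet k (mulOneSub (-l) (mulOneSub l (mulOneSub m f)))
      = staircaseDet k (mulOneSub m f) := fun k => by
    rw [mulOneSub_neg_self, staircaseDet_sub_shift_two k (mulOneSub_eq_zero hf m)]
  have hm : ∀ k, staircaseDet k (mulOneSub (-m) (mulOneSub l (mulOneSub m f)))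
      = staircaseDet k (mulOneSub l f) := fun k => by
    rw [mulOneSub_comm l m, mulOneSub_neg_self,
      staircaseDet_sub_shift_two k (mulOneSub_eq_zero hf l)]
  have hlm : staircaseDet n (mulOneSub (-l) (mulOneSub (-m) (mulOneSub l (mulOneSub m f))))
      = staircaseDet n f := by
    rw [mulOneSub_comm (-m) l, mulOneSub_neg_self l, staircaseDet_sub_shift_two n
      (mulOneSub_eq_zero (mulOneSub_eq_zero hf m) (-m)), mulOneSub_neg_self,
      staircaseDet_sub_shift_two n hf]
  rw [hl, hl, hm, hm, hlm] at key
  linear_combination key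

end StaircaseDet

section Scaling

variable {K : Type*} [Field K]

theorem staircaseDet_zpow_mul {q : K} (hq : q ≠ 0) (n : ℕ) (f : ℤ → K) :
    staircaseDet n (fun k => q ^ k * f k)
      = (∏ i : Fin n, q ^ ((n : ℤ) - (i : ℕ))) * staircaseDet n f := by
  have h : ∀ i : Fin n, q ^ ((n : ℤ) - (i : ℕ))
      = q ^ ((n : ℤ) - 2 * (i : ℕ)) * q ^ (((i : ℕ) : ℤ)) := fun i => by
    rw [← zpow_add₀ hq]
    congr 1
    ring
  simp only [h, Finset.prod_mul_distrib, staircaseDet]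
  rw [mul_assoc, ← det_mul_row, ← det_mul_column]
  congr 1
  ext i j
  simp only [of_apply]
  rw [zpow_add₀ hq]
  ring

theorem prod_zpow_sub_succ (q : K) (n : ℕ) :
    ∏ i : Fin (n + 1), q ^ (((n + 1 : ℕ) : ℤ) - (i : ℕ))
      = q ^ (n + 1) * ∏ i : Fin n, q ^ ((n : ℤ) - (i : ℕ)) := by
  rw [Fin.prod_univ_succ]
  congr 1
  · rw [← zpow_natCast]
    simp
  · refine Finset.prod_congr rfl fun i _ => ?_
    congr 1
    push_cast [Fin.val_succ]
    ring

theorem phiAux_eq_staircaseDet (p : ℤ → K → K → K) (n : ℕ) (y z : K) :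
    phiAux p n y z = staircaseDet n (fun k => p k y z) := rfl

theorem phi_natCast (p : ℤ → K → K → K) (n : ℕ) (y z : K) :
    phi p (n : ℤ) y z = phiAux p n y z := by
  simp [phi]

theorem exists_phi_neg_eq (p : ℤ → K → K → K) (n : ℕ) :
    ∃ s : K, ∀ y z, phi p (-(n : ℤ) - 1) y z = s * phiAux p n y z := by
  refine ⟨(-1 : K) ^ ((-(n : ℤ) - 1) * (-(n : ℤ) - 1 + 1) / 2), fun y z => ?_⟩
  have h : (-(-(n : ℤ) - 1) - 1).toNat = n := by omega
  rw [phi, if_neg (by omega), h]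

end Scaling

theorem bilinear_bl2
    {K : Type*} [Field K] (q : K) (hq0 : q ≠ 0)
    (hq1 : ∀ k : ℕ, 1 ≤ k → q ^ k ≠ 1)
    (p : ℤ → K → K → K)
    (hp_neg : ∀ k : ℤ, k < 0 → ∀ y z : K, p k y z = 0)
    (hp_zero : ∀ y z : K, p 0 y z = 1)
    (hC1 : ∀ k : ℕ, 1 ≤ k → ∀ y z : K,
      (∑ i ∈ Finset.range k, q ^ i) * p (k : ℤ) y z
        = (y + z + q ^ (k - 1)) * p ((k : ℤ) - 1) y z
          - (1 - q) * y * z * p ((k : ℤ) - 2) y z)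
    (hC2 : ∀ (k : ℤ) (y z : K), p k y (q * z) - p k y z = (q - 1) * z * p (k - 1) y z)
    (hC3 : ∀ (k : ℤ) (y z : K), p k (q * y) z - p k y z = (q - 1) * y * p (k - 1) y z)
    (N : ℤ) (y z : K) :
    q ^ (-N - 1) * z * phi p (N + 1) y z * phi p N (y / q) z
      + phi p (N + 1) (y / q) z * phi p N y z
    = (1 + z) * phi p (N + 1) (y / q) (z / q) * phi p N y (q * z) := by
  have hq1' : 1 - q ≠ 0 := sub_ne_zero.mpr fun h => hq1 1 le_rfl (by rw [pow_one, ← h])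
  obtain ⟨u, rfl⟩ : ∃ u, y = q * u := ⟨y / q, by field_simp⟩
  obtain ⟨v, rfl⟩ : ∃ v, z = q * v := ⟨z / q, by field_simp⟩
  rw [mul_div_cancel_left₀ u hq0, mul_div_cancel_left₀ v hq0]
  set l : K := (1 - q) * v with hl
  set m : K := -((1 - q) / q) with hm
  have hm0 : m ≠ 0 := neg_ne_zero.mpr (div_ne_zero hq1' hq0)
  have hlm : l = -(q * v) * m := by
    rw [hl, hm]
    field_simp
  set f : ℤ → K := fun k => p k u v with hf
  have hfneg : ∀ k < 0, f k = 0 := fun k hk => hp_neg k hk u v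
  have e1 : (fun k => p k u (q * v)) = mulOneSub l f := by
    funext k
    simp only [mulOneSub, hf, hl]
    linear_combination hC2 k u v
  have e2 : (fun k => p k (q * u) (q * v)) = fun k => q ^ k * mulOneSub m f k := by
    funext k
    have hs : p k (q * u) (q * v) = p k u v - (1 - q) * (u + v) * p (k - 1) u v
        + (1 - q) ^ 2 * u * v * p (k - 2) u v := by
      have h1 := hC2 (k - 1) u v
      rw [sub_sub, one_add_one_eq_two] at h1
      linear_combination hC3 k u (q * v) + hC2 k u v + (q - 1) * u * h1
    rw [hs]
    simp only [mulOneSub, hf, hm]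
    rcases lt_trichotomy k 0 with hk | rfl | hk
    · rw [hp_neg k hk, hp_neg (k - 1) (by omega), hp_neg (k - 2) (by omega)]
      ring
    · rw [hp_neg (0 - 1) (by omega), hp_neg (0 - 2) (by omega)]
      simp
    · obtain ⟨j, rfl⟩ : ∃ j : ℕ, k = ((j + 1 : ℕ) : ℤ) := ⟨(k - 1).toNat, by omega⟩
      have h := hC1 (j + 1) (by omega) u v
      have hg := geom_sum_mul q (j + 1)
      rw [zpow_natCast]
      have hq' : q ^ (j + 1) * ((1 - q) / q) = q ^ j * (1 - q) := by
        rw [pow_succ]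
        field_simp
      rw [Nat.add_sub_cancel] at h
      linear_combination (1 - q) * h + p ((j + 1 : ℕ) : ℤ) u v * hg
        - p (((j + 1 : ℕ) : ℤ) - 1) u v * hq'
  have e3 : (fun k => p k (q * u) (q * (q * v)))
      = fun k => q ^ k * mulOneSub l (mulOneSub m f) k := by
    funext k
    have h1 := congrFun e2 k
    have h2 := congrFun e2 (k - 1)
    beta_reduce at h1 h2
    rw [zpow_sub_one₀ hq0] at h2
    have h3 := hC2 k (q * u) (q * v)
    rw [h1, h2] at h3
    have hqq : q⁻¹ * q = 1 := inv_mul_cancel₀ hq0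
    rw [show mulOneSub l (mulOneSub m f) k
      = mulOneSub m f k - l * mulOneSub m f (k - 1) from rfl, hl]
    linear_combination h3 + (q - 1) * v * q ^ k * mulOneSub m f (k - 1) * hqq
  have t0 : ∀ n, phiAux p n u v = staircaseDet n f := fun n => rfl
  have t1 : ∀ n, phiAux p n u (q * v) = staircaseDet n (mulOneSub l f) := fun n => by
    rw [phiAux_eq_staircaseDet, e1]
  have t2 : ∀ n, phiAux p n (q * u) (q * v)
      = (∏ i : Fin n, q ^ ((n : ℤ) - (i : ℕ))) * staircaseDet n (mulOneSub m f) := fun n => by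
    rw [phiAux_eq_staircaseDet, e2, staircaseDet_zpow_mul hq0]
  have t3 : ∀ n, phiAux p n (q * u) (q * (q * v)) = (∏ i : Fin n, q ^ ((n : ℤ) - (i : ℕ)))
      * staircaseDet n (mulOneSub l (mulOneSub m f)) := fun n => by
    rw [phiAux_eq_staircaseDet, e3, staircaseDet_zpow_mul hq0]
  rcases le_or_gt 0 N with hN | hN
  · lift N to ℕ using hN with n
    have hn : (n : ℤ) + 1 = ((n + 1 : ℕ) : ℤ) := by push_cast; rfl
    have hpow : q ^ (-(n : ℤ) - 1) * q ^ (n + 1) = 1 := by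
      rw [← zpow_natCast, ← zpow_add₀ hq0]
      simp
    rw [hn]
    simp only [phi_natCast, t0, t1, t2, t3, prod_zpow_sub_succ]
    generalize (∏ i : Fin n, q ^ ((n : ℤ) - (i : ℕ))) = c
    have key := staircaseDet_bilinear n f l m
    generalize staircaseDet n (mulOneSub l (mulOneSub m f)) = A at *
    apply mul_left_cancel₀ hm0
    linear_combination -c * key
      + c * (staircaseDet (n + 1) (mulOneSub m f) * staircaseDet n (mulOneSub l f)
        - staircaseDet (n + 1) f * A) * hlm
      + m * (q * v) * c * staircaseDet (n + 1) (mulOneSub m f)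
      * staircaseDet n (mulOneSub l f) * hpow
  · obtain ⟨n, rfl⟩ : ∃ n : ℕ, N = -(n : ℤ) - 1 := ⟨(-N - 1).toNat, by omega⟩
    obtain ⟨s, hs⟩ := exists_phi_neg_eq p n
    rw [show -(-(n : ℤ) - 1) - 1 = (n : ℤ) by ring, sub_add_cancel, zpow_natCast]
    cases n with
    | zero =>
      have h0 : ∀ y z, phi p (-((0 : ℕ) : ℤ)) y z = 1 := fun y z => by simp [phi, phiAux]
      have h1 : ∀ y z, phiAux p 0 y z = 1 := fun y z => by simp [phiAux]
      simp only [hs, h0, h1]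
      ring
    | succ n =>
      obtain ⟨s', hs'⟩ := exists_phi_neg_eq p n
      have hn : -((n + 1 : ℕ) : ℤ) = -(n : ℤ) - 1 := by push_cast; ring
      simp only [hs]
      rw [hn]
      simp only [hs', t0, t1, t2, t3, prod_zpow_sub_succ]
      generalize (∏ i : Fin n, q ^ ((n : ℤ) - (i : ℕ))) = c
      have key := staircaseDet_bilinear_dual n hfneg l m
      generalize staircaseDet (n + 1) (mulOneSub l (mulOneSub m f)) = A at *
      apply mul_left_cancel₀ hm0
      linear_combination s * s' * c * q ^ (n + 1) * (key + (staircaseDet (n + 1) (mulOneSub l f)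
        * staircaseDet n (mulOneSub m f) - A * staircaseDet n f) * hlm)
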